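/- Let R be a Noetherian commutative ring of prime characteristic p and let M be a finitely generated R-module that has finite F-representation type over R. Then: (a) for every multiplicatively closed subset W of R, the W^{-1}R-module W^{-1}M has finite F-representation type over W^{-1}R; and (b) for every ideal I of R, the I-adic completion of M has finite F-representation type over the I-adic completion of R. -/

import Mathlib

open scoped DirectSum

universe u v w

/-- `FrobIso R q M N` states that the `R`-module `M` with scalar action twisted by `r ↦ r ^ q`
(that is, the Frobenius pushforward `F_*ᵉ M` when `q = p ^ e`) is isomorphic to the `R`-module
`N`: there is an additive isomorphism `g : M ≃+ N` with `g (r ^ q • m) = r • g m`. -/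
def FrobIso (R : Type u) [CommSemiring R] (q : ℕ)
    (M : Type v) [AddCommMonoid M] [Module R M]
    (N : Type w) [AddCommMonoid N] [Module R N] : Prop :=
  ∃ g : M ≃+ N, ∀ (r : R) (m : M), g (r ^ q • m) = r • g m

/-- A module `N` over a ring `R` of prime characteristic `p` has finite F-representation type:
there are finitely many finitely generated `R`-modules `M 0, …, M (s-1)` such that for every
`e ≥ 1` the Frobenius pushforward `F_*ᵉ N` is isomorphic to a finite direct sum of copies of
the `M i`. -/
def HasFFRTModule (p : ℕ) (R : Type u) [CommRing R]
    (N : Type v) [AddCommMonoid N] [Module R N] : Prop :=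
  ∃ (s : ℕ) (M : Fin s → ModuleCat.{u} R),
    (∀ i, Module.Finite R (M i)) ∧
    ∀ e : ℕ, 1 ≤ e → ∃ t : Fin s → ℕ,
      FrobIso R (p ^ e) N (⨁ i, Fin (t i) → ↥(M i))

/-- A ring `R` of prime characteristic `p` has finite F-representation type. -/
def HasFFRT (p : ℕ) (R : Type u) [CommRing R] : Prop :=
  HasFFRTModule p R R

/-- The `e`-th iterated Frobenius `x ↦ x ^ p ^ e` as a ring homomorphism. -/
noncomputable def frobPow (R : Type u) [CommSemiring R] (p : ℕ) [Fact p.Prime] [CharP R p]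
    (e : ℕ) : R →+* R :=
  haveI : ExpChar R p := .prime Fact.out
  iterateFrobenius R p e

/-- `F_*ᵉ M` : the module `M` with `R`-action `r • m = r ^ p ^ e • m`. -/
@[nolint unusedArguments]
def FStar (R : Type u) [CommSemiring R] (p e : ℕ) [Fact p.Prime] [CharP R p]
    (M : Type v) [AddCommMonoid M] [Module R M] : Type v := M

instance (R : Type u) [CommSemiring R] (p e : ℕ) [Fact p.Prime] [CharP R p]
    (M : Type v) [AddCommMonoid M] [Module R M] : AddCommMonoid (FStar R p e M) :=
  inferInstanceAs (AddCommMonoid M)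

instance (R : Type u) [CommSemiring R] (p e : ℕ) [Fact p.Prime] [CharP R p]
    (M : Type v) [AddCommGroup M] [Module R M] : AddCommGroup (FStar R p e M) :=
  inferInstanceAs (AddCommGroup M)

noncomputable instance (R : Type u) [CommSemiring R] (p e : ℕ) [Fact p.Prime] [CharP R p]
    (M : Type v) [AddCommMonoid M] [Module R M] : Module R (FStar R p e M) :=
  Module.compHom M (frobPow R p e)

instance (R : Type u) [CommRing R] (p e : ℕ) [Fact p.Prime] [CharP R p]
    (M : Type v) [AddCommMonoid M] [Module R M] : SMulCommClass R R (FStar R p e M) where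
  smul_comm a b m := by
    rw [smul_smul, smul_smul, mul_comm]

/-- `a` is the maximal rank of a free direct summand of the Frobenius pushforward `F_*ᵉ R`:
`F_*ᵉ R ≅ Rᵃ ⊕ L` where `L` has no nonzero free direct summand. -/
def IsMaxFreeRank (p e : ℕ) (R : Type u) [CommRing R] (a : ℕ) : Prop :=
  ∃ L : ModuleCat.{u} R,
    FrobIso R (p ^ e) R ((Fin a → R) × ↥L) ∧
    ¬ ∃ L' : ModuleCat.{u} R, Nonempty (↥L ≃ₗ[R] R × ↥L')

/-- `N` is an indecomposable `R`-module: it is nonzero and is not the (internal) direct sum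
of two nonzero submodules. -/
def IsIndecomposable (R : Type u) [Ring R] (N : Type v) [AddCommGroup N] [Module R N] : Prop :=
  Nontrivial N ∧ ∀ A B : Submodule R N, IsCompl A B → A = ⊥ ∨ B = ⊥

open scoped TensorProduct

section

variable {R : Type u} [CommRing R]

lemma FrobIso.trans_linearEquiv {q : ℕ} {M : Type v} [AddCommMonoid M] [Module R M]
    {N : Type w} [AddCommMonoid N] [Module R N] {N' : Type*} [AddCommMonoid N'] [Module R N']
    (h : FrobIso R q M N) (f : N ≃ₗ[R] N') : FrobIso R q M N' := by
  obtain ⟨g, hg⟩ := h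
  exact ⟨g.trans f.toAddEquiv, fun r m => by simp [hg]⟩

/-- Base change commutes with finite direct sums of finite powers. -/
noncomputable def tensorDirectSumPowEquiv (A : Type u) [CommRing A] [Algebra R A] {s : ℕ}
    (N : Fin s → Type u) [∀ i, AddCommGroup (N i)] [∀ i, Module R (N i)] (t : Fin s → ℕ) :
    A ⊗[R] (⨁ i, Fin (t i) → N i) ≃ₗ[A] ⨁ i, Fin (t i) → A ⊗[R] N i :=
  (TensorProduct.directSumRight R A A fun i => Fin (t i) → N i).trans
    (DFinsupp.mapRange.linearEquiv fun i => TensorProduct.piRight R A A fun _ : Fin (t i) => N i)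

lemma HasFFRTModule.of_frobIso_baseChange {p : ℕ} (A : Type u) [CommRing A] [Algebra R A]
    {M : Type u} [AddCommGroup M] [Module R M] {M' : Type u} [AddCommGroup M'] [Module A M']
    (hM : HasFFRTModule p R M)
    (H : ∀ (e : ℕ) (N : Type u) [AddCommGroup N] [Module R N] [Module.Finite R N],
      FrobIso R (p ^ e) M N → FrobIso A (p ^ e) M' (A ⊗[R] N)) :
    HasFFRTModule p A M' := by
  obtain ⟨s, N, hN, h⟩ := hM
  refine ⟨s, fun i => ModuleCat.of A (A ⊗[R] N i), fun i => ?_, fun e he => ?_⟩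
  · have := hN i
    exact inferInstanceAs (Module.Finite A (A ⊗[R] N i))
  · obtain ⟨t, ht⟩ := h e he
    have : Module.Finite R (⨁ i, Fin (t i) → N i) :=
      Module.Finite.equiv (DirectSum.linearEquivFunOnFintype R _ _).symm
    exact ⟨t, (H e _ ht).trans_linearEquiv (tensorDirectSumPowEquiv A (fun i => N i) t)⟩

end

section

variable {p : ℕ} [Fact p.Prime] {R : Type u} [CommRing R] [CharP R p]

lemma frobPow_apply (e : ℕ) (r : R) : frobPow R p e r = r ^ p ^ e := rfl

/-- The Frobenius pushforward of an `R`-linear map. -/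
def FStar.map (e : ℕ) {M : Type v} [AddCommGroup M] [Module R M] {N : Type w} [AddCommGroup N]
    [Module R N] (f : M →ₗ[R] N) : FStar R p e M →ₗ[R] FStar R p e N where
  toFun := f
  map_add' := f.map_add
  map_smul' r := f.map_smul (r ^ p ^ e)

lemma FStar.isUnit_algebraMap_end (e : ℕ) {M : Type v} [AddCommGroup M] [Module R M] {r : R}
    (hr : IsUnit (algebraMap R (Module.End R M) r)) :
    IsUnit (algebraMap R (Module.End R (FStar R p e M)) r) := by
  rw [Module.End.isUnit_iff]
  have h := hr.pow (p ^ e)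
  rw [← map_pow, Module.End.isUnit_iff] at h
  exact h

instance FStar.isLocalizedModule_map (e : ℕ) (W : Submonoid R) {M : Type v} [AddCommGroup M]
    [Module R M] {N : Type w} [AddCommGroup N] [Module R N] (f : M →ₗ[R] N)
    [IsLocalizedModule W f] : IsLocalizedModule W (FStar.map (p := p) e f) where
  map_units w := FStar.isUnit_algebraMap_end e (IsLocalizedModule.map_units f w)
  surj := fun (y : N) => by
    obtain ⟨⟨m, w⟩, h⟩ := IsLocalizedModule.surj W f y
    have hq : p ^ e ≠ 0 := pow_ne_zero _ (Fact.out : p.Prime).ne_zero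
    obtain ⟨k, hk⟩ := Nat.exists_eq_succ_of_ne_zero hq
    refine ⟨⟨((w : R) ^ k • m : M), w⟩, ?_⟩
    change (w : R) ^ p ^ e • y = f ((w : R) ^ k • m)
    change (w : R) • y = f m at h
    rw [map_smul, ← h, smul_smul, hk, pow_succ]
  exists_of_eq := fun {x y : M} h => by
    obtain ⟨c, hc⟩ := IsLocalizedModule.exists_of_eq (S := W) (f := f) h
    have hq : p ^ e ≠ 0 := pow_ne_zero _ (Fact.out : p.Prime).ne_zero
    obtain ⟨k, hk⟩ := Nat.exists_eq_succ_of_ne_zero hq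
    refine ⟨c, ?_⟩
    change (c : R) ^ p ^ e • x = (c : R) ^ p ^ e • y
    change (c : R) • x = (c : R) • y at hc
    rw [hk, pow_succ, mul_smul, mul_smul, hc]

lemma FrobIso.localizedModule {e : ℕ} (W : Submonoid R) {M N : Type u} [AddCommGroup M]
    [Module R M] [AddCommGroup N] [Module R N] (h : FrobIso R (p ^ e) M N) :
    FrobIso (Localization W) (p ^ e) (LocalizedModule W M) (Localization W ⊗[R] N) := by
  obtain ⟨g, hg⟩ := h
  let g' : FStar R p e M ≃ₗ[R] N := { g with map_smul' := hg }
  let φ : FStar R p e M →ₗ[R] FStar R p e (LocalizedModule W M) :=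
    FStar.map e (LocalizedModule.mkLinearMap W M)
  let ι : N →ₗ[R] Localization W ⊗[R] N := TensorProduct.mk R (Localization W) N 1
  have hι : IsLocalizedModule W ι :=
    (isLocalizedModule_iff_isBaseChange W (Localization W) ι).mpr (TensorProduct.isBaseChange ..)
  have hι' : IsLocalizedModule W (ι ∘ₗ g'.toLinearMap) :=
    IsLocalizedModule.of_linearEquiv_right W ι g'
  let L : FStar R p e (LocalizedModule W M) ≃ₗ[R] Localization W ⊗[R] N :=
    IsLocalizedModule.linearEquiv W φ (ι ∘ₗ g'.toLinearMap)
  let G : LocalizedModule W M ≃+ Localization W ⊗[R] N := L.toAddEquiv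
  have hG (r : R) (m : LocalizedModule W M) : G (r ^ p ^ e • m) = r • G m := L.map_smul r m
  refine ⟨G, fun x m => ?_⟩
  obtain ⟨⟨r, w⟩, hx⟩ := IsLocalization.surj W x
  apply IsLocalizedModule.smul_injective ι w
  change (w : R) • G _ = (w : R) • x • G m
  replace hx : (w : R) • x = algebraMap R (Localization W) r := by
    rw [Algebra.smul_def, mul_comm]; exact hx
  rw [← hG, ← smul_assoc, ← smul_assoc, ← smul_pow, hx, ← map_pow, algebraMap_smul,
    algebraMap_smul, hG]

/-- The semilinear isomorphism underlying an isomorphism `F_*ᵉ M ≃ N`. -/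
noncomputable def frobSemilinearMap {e : ℕ} {M N : Type u} [AddCommGroup M]
    [Module R M] [AddCommGroup N] [Module R N] (g : M ≃+ N)
    (hg : ∀ (r : R) (m : M), g (r ^ p ^ e • m) = r • g m) : N →ₛₗ[frobPow R p e] M where
  toFun := g.symm
  map_add' := g.symm.map_add
  map_smul' r n := by
    rw [AddEquiv.symm_apply_eq, frobPow_apply, hg, AddEquiv.apply_symm_apply]

section Semilinear

variable {e : ℕ} {M N : Type u} [AddCommGroup M] [Module R M] [AddCommGroup N] [Module R N]

lemma pow_smul_top_le_comap (f : N →ₛₗ[frobPow R p e] M) (J : Ideal R) :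
    (J • ⊤ : Submodule R N) ≤ (J • ⊤ : Submodule R M).comap f := by
  rw [Submodule.smul_le]
  intro r hr n _
  rw [Submodule.mem_comap, map_smulₛₗ, frobPow_apply]
  exact Submodule.smul_mem_smul
    (J.pow_mem_of_mem hr _ (pow_pos (Fact.out : p.Prime).pos e)) trivial

lemma mem_smul_top_of_map_mem {f : N →ₛₗ[frobPow R p e] M} (hf : Function.Bijective f)
    (J : Ideal R) {n : N} (hn : f n ∈ (J.map (frobPow R p e) • ⊤ : Submodule R M)) :
    n ∈ (J • ⊤ : Submodule R N) := by
  suffices h : ∀ m ∈ (J.map (frobPow R p e) • ⊤ : Submodule R M),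
      ∃ n ∈ (J • ⊤ : Submodule R N), f n = m by
    obtain ⟨n', hn', h'⟩ := h _ hn
    rwa [← hf.1 h']
  intro m hm
  induction hm using Submodule.smul_induction_on' with
  | smul r hr m _ =>
    rw [Ideal.map] at hr
    induction hr using Submodule.span_induction generalizing m with
    | mem r hr =>
      obtain ⟨s, hs, rfl⟩ := hr
      obtain ⟨n, rfl⟩ := hf.2 m
      exact ⟨s • n, Submodule.smul_mem_smul hs trivial, map_smulₛₗ f s n⟩
    | zero => exact ⟨0, zero_mem _, by simp⟩
    | add a b _ _ ha hb =>
      obtain ⟨x, hx, hx'⟩ := ha m trivial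
      obtain ⟨y, hy, hy'⟩ := hb m trivial
      exact ⟨x + y, add_mem hx hy, by rw [map_add, hx', hy', add_smul]⟩
    | smul a b _ hb =>
      rw [smul_eq_mul, mul_comm, mul_smul]
      exact hb _ trivial
  | add x _ y _ hx hy =>
    obtain ⟨x', hx, rfl⟩ := hx
    obtain ⟨y', hy, rfl⟩ := hy
    exact ⟨x' + y', add_mem hx hy, map_add f x' y'⟩

lemma exists_pow_le_map_frobPow [IsNoetherianRing R] (I : Ideal R) (e : ℕ) :
    ∃ k ≠ 0, ∀ n, I ^ (k * n) ≤ (I ^ n).map (frobPow R p e) := by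
  have hle : I ≤ (I.map (frobPow R p e)).radical :=
    fun r hr => ⟨p ^ e, Ideal.mem_map_of_mem (frobPow R p e) hr⟩
  obtain ⟨k, hk⟩ := Ideal.exists_pow_le_of_le_radical_of_fg hle (IsNoetherian.noetherian I)
  refine ⟨k + 1, k.succ_ne_zero, fun n => ?_⟩
  rw [pow_mul, Ideal.map_pow]
  exact Ideal.pow_right_mono ((Ideal.pow_le_pow_right k.le_succ).trans hk) n

/-- The map on adic completions induced by a Frobenius-semilinear map. -/
noncomputable def AdicCompletion.frobMap (I : Ideal R) (f : N →ₛₗ[frobPow R p e] M) :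
    AdicCompletion I N →+ AdicCompletion I M where
  toFun x := ⟨fun n => Submodule.mapQ _ _ f (pow_smul_top_le_comap f (I ^ n)) (x.val n), by
    intro m n hmn
    induction x using AdicCompletion.induction_on with
    | _ a =>
      change Submodule.Quotient.mk (f (a n)) = Submodule.Quotient.mk (f (a m))
      have := congrArg (Submodule.mapQ _ _ f (pow_smul_top_le_comap f (I ^ m)))
        (AdicCompletion.AdicCauchySequence.mk_eq_mk hmn a)
      exact this⟩
  map_zero' := by ext n; exact (Submodule.mapQ _ _ f (pow_smul_top_le_comap f (I ^ n))).map_zero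
  map_add' x y := by ext n; exact (Submodule.mapQ _ _ f (pow_smul_top_le_comap f (I ^ n))).map_add _ _

lemma AdicCompletion.frobMap_smul (I : Ideal R) (f : N →ₛₗ[frobPow R p e] M)
    (r : AdicCompletion I R) (x : AdicCompletion I N) :
    frobMap I f (r • x) = r ^ p ^ e • frobMap I f x := by
  ext n
  induction x using AdicCompletion.induction_on with
  | _ a =>
    induction r using AdicCompletion.induction_on with
    | _ b =>
      change Submodule.Quotient.mk (f (b n • a n)) = Submodule.Quotient.mk (b n ^ p ^ e • f (a n))
      rw [map_smulₛₗ, frobPow_apply]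

lemma AdicCompletion.frobMap_bijective [IsNoetherianRing R] (I : Ideal R)
    {f : N →ₛₗ[frobPow R p e] M} (hf : Function.Bijective f) :
    Function.Bijective (frobMap I f) := by
  obtain ⟨k, hk0, hk⟩ := exists_pow_le_map_frobPow (p := p) I e
  have hle (n : ℕ) : n ≤ k * n := Nat.le_mul_of_pos_left n (Nat.pos_of_ne_zero hk0)
  have hmem (n : ℕ) (x : N) (hx : f x ∈ (I ^ (k * n) • ⊤ : Submodule R M)) :
      x ∈ (I ^ n • ⊤ : Submodule R N) :=
    mem_smul_top_of_map_mem hf _ (Submodule.smul_mono_left (hk n) hx)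
  constructor
  · rw [injective_iff_map_eq_zero]
    intro x hx
    ext n
    induction x using AdicCompletion.induction_on with
    | _ a =>
      have h : Submodule.Quotient.mk (p := (I ^ (k * n) • ⊤ : Submodule R M)) (f (a (k * n))) = 0 :=
        congrArg (fun y : AdicCompletion I M => y.val (k * n)) hx
      rw [Submodule.Quotient.mk_eq_zero] at h
      change Submodule.Quotient.mk (p := (I ^ n • ⊤ : Submodule R N)) (a n) = 0
      rw [← AdicCauchySequence.mk_eq_mk (hle n) a, Submodule.Quotient.mk_eq_zero]
      exact hmem n _ h
  · intro y
    induction y using AdicCompletion.induction_on with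
    | _ a =>
      choose b hb using fun n => hf.2 (a (k * n))
      refine ⟨mk I N (AdicCauchySequence.mk I N b fun n => ?_), ?_⟩
      · rw [SModEq.sub_mem]
        apply hmem
        rw [map_sub, hb, hb, ← SModEq.sub_mem]
        exact a.2 (Nat.mul_le_mul_left k n.le_succ)
      · ext n
        change Submodule.Quotient.mk (f (b n)) = Submodule.Quotient.mk (a n)
        rw [hb]
        exact AdicCauchySequence.mk_eq_mk (hle n) a

lemma FrobIso.adicCompletion [IsNoetherianRing R] [Module.Finite R N] (I : Ideal R)
    (h : FrobIso R (p ^ e) M N) :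
    FrobIso (AdicCompletion I R) (p ^ e) (AdicCompletion I M) (AdicCompletion I R ⊗[R] N) := by
  obtain ⟨g, hg⟩ := h
  let f := frobSemilinearMap g hg
  let E : AdicCompletion I N ≃+ AdicCompletion I M :=
    AddEquiv.ofBijective _ (AdicCompletion.frobMap_bijective I (f := f) g.symm.bijective)
  have hE : FrobIso (AdicCompletion I R) (p ^ e) (AdicCompletion I M) (AdicCompletion I N) := by
    refine ⟨E.symm, fun r m => ?_⟩
    rw [AddEquiv.symm_apply_eq]
    refine Eq.trans ?_ (AdicCompletion.frobMap_smul I f r (E.symm m)).symm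
    exact congrArg (r ^ p ^ e • ·) (E.apply_symm_apply m).symm
  exact hE.trans_linearEquiv (AdicCompletion.ofTensorProductEquivOfFiniteNoetherian I N).symm

end Semilinear

end

theorem statement5 (p : ℕ) [Fact p.Prime] (R : Type u) [CommRing R] [IsNoetherianRing R]
    [CharP R p] (M : Type u) [AddCommGroup M] [Module R M] [Module.Finite R M]
    (hM : HasFFRTModule p R M) :
    (∀ W : Submonoid R, HasFFRTModule p (Localization W) (LocalizedModule W M)) ∧
    (∀ I : Ideal R, HasFFRTModule p (AdicCompletion I R) (AdicCompletion I M)) :=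
  ⟨fun W => hM.of_frobIso_baseChange (Localization W) fun _ _ _ _ _ h => h.localizedModule W,
    fun I => hM.of_frobIso_baseChange (AdicCompletion I R) fun _ _ _ _ _ h => h.adicCompletion I⟩
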